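/- Under the two-component Gaussian mixture setup with ρ the density of N(0, σ²I_d), σ > 0, for any δ ∈ (0,1), with probability at least 1 − δ over the i.i.d. sample X^(1),…,X^(n) ~ P_X, the following holds: for every Borel probability measure Q on ℝ^d with finite first moment satisfying W₁((p_j)_*P̂ⁿ, (p_j)_*Q) ≤ ε_j for all j ∈ {1,…,d}, every k ∈ {1,2}, and every r ∈ (0,Δ), one has |Q({x ∈ ℝ^d : max_{j∈[d]} |x_j − μ⁽ᵏ⁾_j| ≤ r}) − w_k| ≤ 4d exp(−r²/(2σ²)) + 8d√(max_{j∈[d]} ε_j / σ) + 5d√(log(16d/δ)/(2n)) + W₁(P̂ⁿ, Q)/(2(Δ − r)). -/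

import Mathlib

open MeasureTheory Set
open scoped ENNReal

/-- The 1-Wasserstein distance between two measures, defined via the primal
(optimal transport) formulation: the infimum of `∫ ‖x - y‖ dπ` over all
couplings `π` of `μ` and `ν`. -/
noncomputable def W1 {E : Type*} [MeasurableSpace E] [NormedAddCommGroup E]
    (μ ν : Measure E) : ℝ :=
  sInf {c : ℝ | ∃ π : Measure (E × E), IsProbabilityMeasure π ∧
    π.map Prod.fst = μ ∧ π.map Prod.snd = ν ∧ c = ∫ p, ‖p.1 - p.2‖ ∂π}

/-- A measure has a finite first moment. -/
def FiniteFirstMoment {E : Type*} [MeasurableSpace E] [NormedAddCommGroup E]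
    (μ : Measure E) : Prop :=
  HasFiniteIntegral (fun x => ‖x‖) μ

/-- The empirical measure of a sample `x : Fin n → E`. -/
noncomputable def empMeasure {E : Type*} [MeasurableSpace E] {n : ℕ}
    (x : Fin n → E) : Measure E :=
  (n : ℝ≥0∞)⁻¹ • ∑ i : Fin n, Measure.dirac (x i)

open ProbabilityTheory

lemma chernoff_indicator_pi {E : Type*} [MeasurableSpace E] (μ : Measure E) [IsProbabilityMeasure μ]
    (n : ℕ) {A : Set E} (hA : MeasurableSet A) {θ q : ℝ} (hθ : 0 ≤ θ) (hq : μ.real A ≤ q) (τ : ℝ) :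
    (Measure.pi fun _ : Fin n => μ) {x | τ ≤ ∑ i, A.indicator (fun _ => (1 : ℝ)) (x i)} ≤
      ENNReal.ofReal (Real.exp (-θ * τ + n * q * (Real.exp θ - 1))) := by
  have hf : Measurable (A.indicator (fun _ => (1 : ℝ))) := measurable_const.indicator hA
  have hind := iIndepFun_pi (μ := fun _ : Fin n => μ) (X := fun _ => A.indicator (fun _ => (1 : ℝ)))
    (fun _ => hf.aemeasurable)
  have hmeas : ∀ i : Fin n, Measurable fun x : Fin n → E => A.indicator (fun _ => (1 : ℝ)) (x i) :=
    fun i => hf.comp (measurable_pi_apply i)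
  have hsum := hind.mgf_sum hmeas Finset.univ (t := θ)
  have h1 (i : Fin n) : mgf (fun x : Fin n → E => A.indicator (fun _ => (1 : ℝ)) (x i))
      (Measure.pi fun _ : Fin n => μ) θ = 1 + μ.real A * (Real.exp θ - 1) := by
    have he : (fun y => Real.exp (θ * A.indicator (fun _ => (1 : ℝ)) y)) =
        fun y => 1 + A.indicator (fun _ => Real.exp θ - 1) y := by
      ext y
      by_cases hy : y ∈ A <;> simp [hy]
    rw [mgf, integral_comp_eval (μ := fun _ : Fin n => μ)
      (f := fun y => Real.exp (θ * A.indicator (fun _ => (1 : ℝ)) y)) (by fun_prop), he,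
      integral_add (integrable_const _) ((integrable_const _).indicator hA),
      integral_indicator_const _ hA]
    simp
  have hbd (x : Fin n → E) : ∑ i, A.indicator (fun _ => (1 : ℝ)) (x i) ≤ n := by
    calc _ ≤ ∑ i : Fin n, (1 : ℝ) :=
          Finset.sum_le_sum fun i _ => indicator_le_self' (fun _ _ => zero_le_one) _
      _ = n := by simp
  have hint : Integrable (fun x : Fin n → E =>
      Real.exp (θ * (∑ i, fun x : Fin n → E => A.indicator (fun _ => (1 : ℝ)) (x i)) x))
      (Measure.pi fun _ : Fin n => μ) := by
    refine Integrable.of_bound (C := Real.exp (θ * n)) (by fun_prop) (ae_of_all _ fun x => ?_)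
    rw [Real.norm_eq_abs, Real.abs_exp, Finset.sum_apply]
    gcongr
    exact hbd x
  have := measure_ge_le_exp_mul_mgf τ hθ hint
  rw [← ofReal_measureReal]
  refine ENNReal.ofReal_le_ofReal ?_
  simp only [Finset.sum_apply] at this
  refine this.trans ?_
  rw [hsum, Real.exp_add]
  gcongr
  simp only [h1, Finset.prod_const, Finset.card_univ, Fintype.card_fin]
  have he : 0 ≤ Real.exp θ - 1 := by linarith [Real.one_le_exp hθ]
  have hA0 : 0 ≤ μ.real A := measureReal_nonneg
  calc _ ≤ (Real.exp (q * (Real.exp θ - 1))) ^ n := by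
        gcongr
        rw [add_comm]
        exact (Real.add_one_le_exp _).trans (by gcongr)
    _ = _ := by rw [← Real.exp_nat_mul]; ring_nf

lemma hoeffding_indicator_pi {E : Type*} [MeasurableSpace E] (μ : Measure E) [IsProbabilityMeasure μ]
    {n : ℕ} (hn : 0 < n) {A : Set E} (hA : MeasurableSet A) {s : ℝ} (hs : 0 ≤ s) :
    (Measure.pi fun _ : Fin n => μ)
        {x | n * (μ.real A + s) ≤ ∑ i, A.indicator (fun _ => (1 : ℝ)) (x i)} ≤
      ENNReal.ofReal (Real.exp (-2 * n * s ^ 2)) := by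
  have hf : Measurable (A.indicator (fun _ => (1 : ℝ))) := measurable_const.indicator hA
  have hint (i : Fin n) : ∫ x, A.indicator (fun _ => (1 : ℝ)) (x i) ∂(Measure.pi fun _ : Fin n => μ)
      = μ.real A := by
    rw [integral_comp_eval (μ := fun _ : Fin n => μ)
      (f := A.indicator (fun _ => (1 : ℝ))) (by fun_prop), integral_indicator_const _ hA]
    simp
  have hind := iIndepFun_pi (μ := fun _ : Fin n => μ)
    (X := fun _ y => A.indicator (fun _ => (1 : ℝ)) y - μ.real A)
    (fun _ => (hf.sub_const _).aemeasurable)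
  have hsub (i : Fin n) : HasSubgaussianMGF
      (fun x : Fin n → E => A.indicator (fun _ => (1 : ℝ)) (x i) - μ.real A)
      ((‖(1 : ℝ) - 0‖₊ / 2) ^ 2) (Measure.pi fun _ : Fin n => μ) := by
    rw [← hint i]
    refine hasSubgaussianMGF_of_mem_Icc (hf.comp (measurable_pi_apply i)).aemeasurable
      (ae_of_all _ fun x => ?_)
    exact ⟨indicator_nonneg (fun _ _ => zero_le_one) _,
      indicator_le_self' (fun _ _ => zero_le_one) _⟩
  have := HasSubgaussianMGF.measure_sum_ge_le_of_iIndepFun hind (s := Finset.univ)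
    (fun i _ => hsub i) (ε := n * s) (by positivity)
  rw [← ofReal_measureReal]
  refine ENNReal.ofReal_le_ofReal ?_
  have hn' : (n : ℝ) ≠ 0 := by positivity
  convert this using 2
  · ext x
    simp only [mem_ofPred_eq, Finset.sum_sub_distrib, Finset.sum_const, Finset.card_univ,
      Fintype.card_fin, nsmul_eq_mul]
    rw [le_sub_iff_add_le]
    ring_nf
  · simp
    field_simp

lemma empMeasure_real {E : Type*} [MeasurableSpace E] {n : ℕ} (x : Fin n → E) {A : Set E}
    (hA : MeasurableSet A) :
    n * (empMeasure x).real A = ∑ i, A.indicator (fun _ => (1 : ℝ)) (x i) := by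
  rcases Nat.eq_zero_or_pos n with rfl | hn
  · simp
  have hn' : (n : ℝ) ≠ 0 := by positivity
  have h (i : Fin n) : (Measure.dirac (x i)).real A = A.indicator (fun _ => (1 : ℝ)) (x i) := by
    rw [measureReal_def, Measure.dirac_apply' _ hA]
    by_cases hx : x i ∈ A <;> simp [hx]
  rw [empMeasure, measureReal_ennreal_smul_apply, measureReal_def, Measure.finsetSum_apply,
    ENNReal.toReal_sum (by simp)]
  simp only [← measureReal_def, h]
  simp [hn']

lemma isProbabilityMeasure_empMeasure {E : Type*} [MeasurableSpace E] {n : ℕ} (hn : 0 < n)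
    (x : Fin n → E) : IsProbabilityMeasure (empMeasure x) := by
  refine ⟨?_⟩
  simp [empMeasure]
  exact ENNReal.inv_mul_cancel (by simpa using hn.ne') (by simp)

lemma finiteFirstMoment_empMeasure {E : Type*} [MeasurableSpace E] [NormedAddCommGroup E]
    [OpensMeasurableSpace E] {n : ℕ} (hn : 0 < n)
    (x : Fin n → E) : FiniteFirstMoment (empMeasure x) := by
  rw [FiniteFirstMoment, HasFiniteIntegral, empMeasure, lintegral_smul_measure,
    lintegral_finsetSum_measure]
  refine ENNReal.mul_lt_top (by simpa using hn) (ENNReal.sum_lt_top.2 fun i _ => ?_)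
  rw [lintegral_dirac' _ (by fun_prop)]
  simp

lemma exists_coupling_of_W1_lt {E : Type*} [NormedAddCommGroup E] [MeasurableSpace E]
    [BorelSpace E] [SecondCountableTopology E] {μ ν : Measure E} [IsProbabilityMeasure μ]
    [IsProbabilityMeasure ν] (hμ : FiniteFirstMoment μ) (hν : FiniteFirstMoment ν) {c : ℝ}
    (hc : W1 μ ν < c) :
    ∃ π : Measure (E × E), IsProbabilityMeasure π ∧ π.map Prod.fst = μ ∧ π.map Prod.snd = ν ∧
      ∀ t > 0, π.real {p | t ≤ ‖p.1 - p.2‖} ≤ c / t := by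
  obtain ⟨_, ⟨π, hπ, h1, h2, rfl⟩, hlt⟩ := exists_lt_of_csInf_lt (by
    exact ⟨_, μ.prod ν, inferInstance, by simp, by simp, rfl⟩) hc
  refine ⟨π, hπ, h1, h2, fun t ht => ?_⟩
  have i1 : Integrable (fun p : E × E => p.1) π := by
    rw [← h1] at hμ
    refine Integrable.comp_measurable (g := fun x : E => x) ⟨by fun_prop, ?_⟩ measurable_fst
    simpa [FiniteFirstMoment, HasFiniteIntegral] using hμ
  have i2 : Integrable (fun p : E × E => p.2) π := by
    rw [← h2] at hν
    refine Integrable.comp_measurable (g := fun x : E => x) ⟨by fun_prop, ?_⟩ measurable_snd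
    simpa [FiniteFirstMoment, HasFiniteIntegral] using hν
  have := mul_meas_ge_le_integral_of_nonneg (ae_of_all π fun p => norm_nonneg (p.1 - p.2))
    (i1.sub i2).norm t
  rw [le_div_iff₀ ht, mul_comm]
  exact this.trans hlt.le

lemma gaussian_kernel_lipschitz {σ : ℝ} (hσ : 0 < σ) (r : ℝ) {t : ℝ} (ht : 0 ≤ t) :
    Real.exp (-r ^ 2 / (2 * σ ^ 2)) ≤ Real.exp (-(r + t) ^ 2 / (2 * σ ^ 2)) + t / σ := by
  have hd (x : ℝ) : HasDerivAt (fun x => Real.exp (-x ^ 2 / (2 * σ ^ 2)))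
      (Real.exp (-x ^ 2 / (2 * σ ^ 2)) * (-(2 * x) / (2 * σ ^ 2))) x := by
    refine HasDerivAt.exp (HasDerivAt.div_const (HasDerivAt.neg ?_) _)
    simpa using hasDerivAt_pow 2 x
  have hb (x : ℝ) : ‖Real.exp (-x ^ 2 / (2 * σ ^ 2)) * (-(2 * x) / (2 * σ ^ 2))‖ ≤ 1 / σ := by
    have h1 : |x| / σ ≤ Real.exp (x ^ 2 / (2 * σ ^ 2)) := by
      refine le_trans ?_ (Real.add_one_le_exp _)
      have h2 : x ^ 2 / (2 * σ ^ 2) = (|x| / σ) ^ 2 / 2 := by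
        rw [div_pow, sq_abs]; ring
      rw [h2]
      nlinarith [sq_nonneg (|x| / σ - 1)]
    rw [norm_mul, Real.norm_eq_abs, Real.abs_exp, Real.norm_eq_abs, abs_div, abs_neg, abs_mul,
      abs_of_pos (by positivity : 0 < 2 * σ ^ 2), neg_div, Real.exp_neg]
    have h3 : |(2 : ℝ)| * |x| / (2 * σ ^ 2) = (|x| / σ) * (1 / σ) := by
      rw [abs_two]; field_simp
    rw [h3, ← mul_assoc]
    refine mul_le_of_le_one_left (by positivity) ?_
    rw [inv_mul_le_iff₀ (Real.exp_pos _)]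
    simpa using h1
  have := convex_univ.norm_image_sub_le_of_norm_hasDerivWithin_le
    (fun x _ => (hd x).hasDerivWithinAt) (fun x _ => hb x) (mem_univ (r + t)) (mem_univ r)
  rw [Real.norm_eq_abs, Real.norm_eq_abs, show r - (r + t) = -t by ring, abs_neg,
    abs_of_nonneg ht] at this
  have h := (le_abs_self _).trans this
  rw [one_div_mul_eq_div] at h
  linarith

section Gaussian

variable {d : ℕ} {σ : ℝ} {ρ : EuclideanSpace ℝ (Fin d) → ℝ}

lemma gaussian_withDensity_translate_le
    (hρ : ∀ x, ρ x = (2 * Real.pi * σ ^ 2) ^ (-(d : ℝ) / 2) *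
      Real.exp (-‖x‖ ^ 2 / (2 * σ ^ 2)))
    {S : Set (EuclideanSpace ℝ (Fin d))} (hS : MeasurableSet S) (v : EuclideanSpace ℝ (Fin d))
    (hv : ∀ u ∈ S, 0 ≤ inner ℝ u v) :
    (volume.withDensity fun x => ENNReal.ofReal (ρ x)) {x | x - v ∈ S} ≤
      ENNReal.ofReal (Real.exp (-‖v‖ ^ 2 / (2 * σ ^ 2))) *
        (volume.withDensity fun x => ENNReal.ofReal (ρ x)) S := by
  have hm : Measurable ρ := by
    rw [funext hρ]; fun_prop
  have hS' : MeasurableSet {x | x - v ∈ S} := (measurable_sub_const v) hS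
  rw [withDensity_apply _ hS', withDensity_apply _ hS, ← lintegral_indicator hS',
    ← lintegral_add_right_eq_self _ v, ← lintegral_indicator hS, ← lintegral_const_mul]
  · refine lintegral_mono fun u => ?_
    by_cases hu : u ∈ S
    · have hu' : u + v ∈ {x | x - v ∈ S} := by simpa using hu
      rw [indicator_of_mem hu, indicator_of_mem hu', ← ENNReal.ofReal_mul (Real.exp_pos _).le]
      refine ENNReal.ofReal_le_ofReal ?_
      rw [hρ, hρ, mul_left_comm, ← Real.exp_add]
      have : ‖u‖ ^ 2 + ‖v‖ ^ 2 ≤ ‖u + v‖ ^ 2 := by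
        rw [norm_add_sq_real]; linarith [hv u hu]
      gcongr
      rw [← add_div]
      gcongr
      linarith
    · have hu' : u + v ∉ {x | x - v ∈ S} := by simpa using hu
      rw [indicator_of_notMem hu']
      exact zero_le
  · exact (by fun_prop : Measurable fun x => ENNReal.ofReal (ρ x)).indicator hS

lemma gaussian_withDensity_halfspace_le
    (hρ : ∀ x, ρ x = (2 * Real.pi * σ ^ 2) ^ (-(d : ℝ) / 2) *
      Real.exp (-‖x‖ ^ 2 / (2 * σ ^ 2)))
    (hN : (volume.withDensity fun x => ENNReal.ofReal (ρ x)) univ = 1) (j : Fin d) {c t : ℝ}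
    (hc : c ^ 2 = 1) (ht : 0 ≤ t) :
    (volume.withDensity fun x => ENNReal.ofReal (ρ x)) {x | t ≤ c * x j} ≤
      ENNReal.ofReal (Real.exp (-t ^ 2 / (2 * σ ^ 2))) := by
  have hS : MeasurableSet {x : EuclideanSpace ℝ (Fin d) | 0 ≤ c * x j} :=
    measurableSet_le (by fun_prop) (by fun_prop)
  have := gaussian_withDensity_translate_le hρ hS (EuclideanSpace.single j (c * t)) fun u hu => by
    have hu' : 0 ≤ c * u j := hu
    simp only [EuclideanSpace.inner_single_right]
    simp
    nlinarith
  refine le_trans (measure_mono fun x hx => ?_) (this.trans ?_)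
  · have hx' : t ≤ c * x j := hx
    simp
    nlinarith
  · rw [PiLp.norm_single, norm_mul, mul_pow, Real.norm_eq_abs, sq_abs, hc, one_mul,
      Real.norm_eq_abs, sq_abs]
    exact mul_le_of_le_one_right' ((measure_mono (subset_univ _)).trans hN.le)

lemma gaussian_withDensity_abs_le
    (hρ : ∀ x, ρ x = (2 * Real.pi * σ ^ 2) ^ (-(d : ℝ) / 2) *
      Real.exp (-‖x‖ ^ 2 / (2 * σ ^ 2)))
    (hN : (volume.withDensity fun x => ENNReal.ofReal (ρ x)) univ = 1) (j : Fin d) {t : ℝ}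
    (ht : 0 ≤ t) :
    (volume.withDensity fun x => ENNReal.ofReal (ρ x)) {x | t < |x j|} ≤
      ENNReal.ofReal (Real.exp (-t ^ 2 / (2 * σ ^ 2))) := by
  set N := volume.withDensity fun x => ENNReal.ofReal (ρ x) with hNdef
  have hS (c : ℝ) : MeasurableSet {x : EuclideanSpace ℝ (Fin d) | 0 < c * x j} :=
    measurableSet_lt (by fun_prop) (by fun_prop)
  have key (c : ℝ) (hc : c ^ 2 = 1) : N {x | t < c * x j} ≤
      ENNReal.ofReal (Real.exp (-t ^ 2 / (2 * σ ^ 2))) * N {x | 0 < c * x j} := by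
    have := gaussian_withDensity_translate_le hρ (hS c) (EuclideanSpace.single j (c * t))
      fun u hu => by
        have hu' : 0 < c * u j := hu
        simp only [EuclideanSpace.inner_single_right]
        simp
        nlinarith
    refine le_trans (measure_mono fun x hx => ?_) (this.trans_eq ?_)
    · have hx' : t < c * x j := hx
      simp
      nlinarith
    · rw [PiLp.norm_single, norm_mul, mul_pow, Real.norm_eq_abs, sq_abs, hc, one_mul,
        Real.norm_eq_abs, sq_abs]
  calc N {x | t < |x j|} ≤ N ({x | t < 1 * x j} ∪ {x | t < -1 * x j}) := by
        refine measure_mono fun x hx => ?_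
        simpa [lt_abs] using hx
    _ ≤ N {x | t < 1 * x j} + N {x | t < -1 * x j} := measure_union_le _ _
    _ ≤ ENNReal.ofReal (Real.exp (-t ^ 2 / (2 * σ ^ 2))) *
        (N {x | 0 < 1 * x j} + N {x | 0 < -1 * x j}) := by
        rw [mul_add]
        exact add_le_add (key _ (by norm_num)) (key _ (by norm_num))
    _ ≤ _ := by
        rw [← measure_union _ (hS (-1))]
        · exact mul_le_of_le_one_right' ((measure_mono (subset_univ _)).trans hN.le)
        · rw [Set.disjoint_left]
          intro x h1 h2
          simp only [mem_ofPred_eq] at h1 h2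
          linarith

lemma mixture_withDensity_apply (hρm : Measurable ρ) (hρ0 : ∀ x, 0 ≤ ρ x) {a b : ℝ} (ha : 0 ≤ a)
    (hb : 0 ≤ b) (u v : EuclideanSpace ℝ (Fin d)) {S : Set (EuclideanSpace ℝ (Fin d))}
    (hS : MeasurableSet S) :
    (volume.withDensity fun x => ENNReal.ofReal (a * ρ (x - u) + b * ρ (x - v))) S =
      ENNReal.ofReal a * (volume.withDensity fun x => ENNReal.ofReal (ρ x)) {x | x + u ∈ S} +
      ENNReal.ofReal b * (volume.withDensity fun x => ENNReal.ofReal (ρ x)) {x | x + v ∈ S} := by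
  have key (m : EuclideanSpace ℝ (Fin d)) : ∫⁻ x in S, ENNReal.ofReal (ρ (x - m)) =
      (volume.withDensity fun x => ENNReal.ofReal (ρ x)) {x | x + m ∈ S} := by
    have hS' : MeasurableSet {x | x + m ∈ S} := (measurable_add_const m) hS
    rw [withDensity_apply _ hS', ← lintegral_indicator hS, ← lintegral_indicator hS',
      ← lintegral_add_right_eq_self _ m]
    refine lintegral_congr fun x => ?_
    by_cases hx : x + m ∈ S
    · rw [indicator_of_mem hx, indicator_of_mem (by exact hx), add_sub_cancel_right]
    · rw [indicator_of_notMem hx, indicator_of_notMem (by exact hx)]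
  rw [withDensity_apply _ hS, ← key, ← key, ← lintegral_const_mul _ (by fun_prop),
    ← lintegral_const_mul _ (by fun_prop), ← lintegral_add_left (by fun_prop)]
  refine lintegral_congr fun x => ?_
  rw [ENNReal.ofReal_add (mul_nonneg ha (hρ0 _)) (mul_nonneg hb (hρ0 _)), ENNReal.ofReal_mul ha,
    ENNReal.ofReal_mul hb]

end Gaussian

/-- The points whose `j`-th coordinate is at distance more than `r` from both `Δ` and `-Δ`. -/
def offModes {d : ℕ} (Δ : ℝ) (j : Fin d) (r : ℝ) : Set (EuclideanSpace ℝ (Fin d)) :=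
  {y | r < |y j - Δ| ∧ r < |y j + Δ|}

/-- The open orthant on the side of the sign `c`. -/
def signOrthant {d : ℕ} (c : ℝ) : Set (EuclideanSpace ℝ (Fin d)) := {y | ∀ j, 0 < c * y j}

lemma measurableSet_offModes {d : ℕ} (Δ : ℝ) (j : Fin d) (r : ℝ) :
    MeasurableSet (offModes Δ j r) := by
  have h (c : ℝ) : MeasurableSet {y : EuclideanSpace ℝ (Fin d) | r < |y j - c|} :=
    measurableSet_lt (by fun_prop) (by fun_prop)
  have h' := (h Δ).inter (h (-Δ))
  simp only [sub_neg_eq_add] at h'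
  exact h'

lemma antitone_offModes {d : ℕ} (Δ : ℝ) (j : Fin d) : Antitone (offModes Δ j) :=
  fun _ _ h _ hy => ⟨h.trans_lt hy.1, h.trans_lt hy.2⟩

lemma measurableSet_signOrthant {d : ℕ} (c : ℝ) :
    MeasurableSet (signOrthant c : Set (EuclideanSpace ℝ (Fin d))) := by
  have : (signOrthant c : Set (EuclideanSpace ℝ (Fin d))) = ⋂ j, {y | 0 < c * y j} := by
    ext; simp [signOrthant]
  rw [this]
  exact MeasurableSet.iInter fun j => measurableSet_lt (by fun_prop) (by fun_prop)

section Mixture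

variable {d : ℕ} {σ : ℝ} {P N : Measure (EuclideanSpace ℝ (Fin d))} {a b : ℝ}
  {u v : EuclideanSpace ℝ (Fin d)}

lemma mixture_real_offModes_le [IsProbabilityMeasure N] (ha : 0 ≤ a) (hb : 0 ≤ b) (hab : a + b = 1)
    (hP : ∀ S, MeasurableSet S → P.real S = a * N.real {x | x + u ∈ S} + b * N.real {x | x + v ∈ S})
    {Δ : ℝ} (hu : ∀ j, u j = Δ) (hv : ∀ j, v j = -Δ) (j : Fin d) {r q : ℝ}
    (hN : N.real {x | r < |x j|} ≤ q) : P.real (offModes Δ j r) ≤ q := by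
  rw [hP _ (measurableSet_offModes Δ j r)]
  have h1 : N.real {x | x + u ∈ offModes Δ j r} ≤ q := by
    refine (measureReal_mono fun x hx => ?_).trans hN
    have := hx.1
    simpa [hu] using this
  have h2 : N.real {x | x + v ∈ offModes Δ j r} ≤ q := by
    refine (measureReal_mono fun x hx => ?_).trans hN
    have := hx.2
    simpa [hv] using this
  calc _ ≤ a * q + b * q := by gcongr
    _ = q := by rw [← add_mul, hab, one_mul]

lemma mixture_real_signOrthant [IsProbabilityMeasure N] (hd : 0 < d) (ha : 0 ≤ a) (hb : 0 ≤ b)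
    (hab : a + b = 1)
    (hP : ∀ S, MeasurableSet S → P.real S = a * N.real {x | x + u ∈ S} + b * N.real {x | x + v ∈ S})
    {Δ c : ℝ} (hc : c ^ 2 = 1) (hu : ∀ j, u j = c * Δ) (hv : ∀ j, v j = -(c * Δ)) {q : ℝ}
    (hN : ∀ j, ∀ e : ℝ, e ^ 2 = 1 → N.real {x | Δ ≤ e * x j} ≤ q) :
    P.real (signOrthant c) ≤ a + q ∧ a - d * q ≤ P.real (signOrthant c) := by
  have hcc : c * (c * Δ) = Δ := by rw [← mul_assoc, ← sq, hc, one_mul]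
  have hq : 0 ≤ q := measureReal_nonneg.trans (hN ⟨0, hd⟩ 1 (by norm_num))
  rw [hP _ (measurableSet_signOrthant c)]
  have h1 : N.real {x | x + u ∈ signOrthant c} ≤ 1 := measureReal_le_one
  have h2 : N.real {x | x + v ∈ signOrthant c} ≤ q := by
    refine (measureReal_mono fun x hx => ?_).trans (hN ⟨0, hd⟩ c hc)
    have := hx ⟨0, hd⟩
    simp only [PiLp.add_apply, hv, mul_add, mul_neg, hcc] at this
    simp only [mem_ofPred_eq]
    linarith
  have h3 : 1 - d * q ≤ N.real {x | x + u ∈ signOrthant c} := by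
    have hm : MeasurableSet {x | x + u ∈ signOrthant c} :=
      (measurable_add_const u) (measurableSet_signOrthant c)
    have hcompl : N.real {x | x + u ∈ signOrthant c}ᶜ ≤ d * q := by
      calc _ ≤ N.real (⋃ j, {x | Δ ≤ (-c) * x j}) := by
            refine measureReal_mono fun x hx => ?_
            simp only [signOrthant, mem_compl_iff, mem_ofPred_eq, not_forall, PiLp.add_apply, hu,
              not_lt, mul_add, hcc] at hx
            obtain ⟨j, hj⟩ := hx
            simp only [mem_iUnion, mem_ofPred_eq]
            exact ⟨j, by linarith⟩
        _ ≤ ∑ j, N.real {x | Δ ≤ (-c) * x j} := measureReal_iUnion_fintype_le _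
        _ ≤ ∑ j : Fin d, q := Finset.sum_le_sum fun j _ => hN j (-c) (by rw [neg_sq, hc])
        _ = d * q := by simp
    rw [probReal_compl_eq_one_sub hm] at hcompl
    linarith
  have h4 : 0 ≤ N.real {x | x + v ∈ signOrthant c} := measureReal_nonneg
  have ha1 : a ≤ 1 := by linarith
  have hb1 : b ≤ 1 := by linarith
  have hdq : 0 ≤ d * q := by positivity
  constructor
  · nlinarith
  · nlinarith

end Mixture

lemma uniform_tail_pi {E : Type*} [MeasurableSpace E] (μ : Measure E) [IsProbabilityMeasure μ]
    {n : ℕ} {A : ℝ → Set E} (hA : ∀ r, MeasurableSet (A r)) (hanti : Antitone A)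
    {σ : ℝ} (hσ : 0 < σ) (htail : ∀ r, 0 ≤ r → μ.real (A r) ≤ Real.exp (-r ^ 2 / (2 * σ ^ 2)))
    {s : ℝ} (hs : 0 < s) (hns : 5 / 2 ≤ n * s) :
    (Measure.pi fun _ : Fin n => μ) {x | ∃ r, 0 ≤ r ∧
        3 / 2 * n * Real.exp (-r ^ 2 / (2 * σ ^ 2)) + 2 * n * s <
          ∑ i, (A r).indicator (fun _ => (1 : ℝ)) (x i)} ≤
      ENNReal.ofReal (7 * Real.exp (-(n * s) / 2)) := by
  set η : ℝ := 2 * s / 3 with hη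
  have hη0 : 0 < η := by positivity
  let R : ℕ → ℝ := fun i => σ * √(-2 * Real.log ((i + 1) * η))
  have hR0 (i : ℕ) : 0 ≤ R i := by positivity
  have hgR (i : ℕ) : μ.real (A (R i)) ≤ (i + 1) * η := by
    have hpos : 0 < ((i : ℝ) + 1) * η := by positivity
    rcases le_total 1 (((i : ℝ) + 1) * η) with h | h
    · exact measureReal_le_one.trans h
    · refine (htail _ (hR0 i)).trans_eq ?_
      have hlog : 0 ≤ -2 * Real.log ((i + 1) * η) := by
        linarith [Real.log_nonpos hpos.le h]
      have : -(R i) ^ 2 / (2 * σ ^ 2) = Real.log ((i + 1) * η) := by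
        simp only [R, mul_pow, Real.sq_sqrt hlog]
        field_simp
      rw [this, Real.exp_log hpos]
  have hle (i : ℕ) {r : ℝ} (hr : 0 ≤ r) (h : Real.exp (-r ^ 2 / (2 * σ ^ 2)) ≤ (i + 1) * η) :
      R i ≤ r := by
    have hpos : 0 < ((i : ℝ) + 1) * η := by positivity
    rw [← Real.le_log_iff_exp_le hpos, neg_div, neg_le] at h
    have h2 : -2 * Real.log ((i + 1) * η) ≤ (r / σ) ^ 2 := by
      calc _ = 2 * -Real.log ((i + 1) * η) := by ring
        _ ≤ 2 * (r ^ 2 / (2 * σ ^ 2)) := by gcongr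
        _ = _ := by field_simp
    calc R i ≤ σ * (r / σ) :=
          mul_le_mul_of_nonneg_left (Real.sqrt_le_iff.2 ⟨by positivity, h2⟩) hσ.le
      _ = r := by field_simp
  have hexp : Real.exp (1 / 2) ≤ 1.65 := by
    have h1 : Real.exp (1 / 2) ^ 2 = Real.exp 1 := by rw [← Real.exp_nat_mul]; norm_num
    have h2 := Real.exp_one_lt_d9
    refine le_of_sq_le_sq ?_ (by norm_num)
    rw [h1]; norm_num at h2 ⊢; linarith
  have hexp6 : Real.exp (-(1 / 6)) ≤ 6 / 7 := by
    rw [Real.exp_neg, inv_le_comm₀ (Real.exp_pos _) (by norm_num)]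
    have := Real.add_one_le_exp (1 / 6 : ℝ)
    norm_num at this ⊢; linarith
  have hbad (i : ℕ) : (Measure.pi fun _ : Fin n => μ) {x | 3 / 2 * n * ((i + 1) * η) + n * s ≤
      ∑ k, (A (R i)).indicator (fun _ => (1 : ℝ)) (x k)} ≤
      ENNReal.ofReal (Real.exp (-(n * s) / 2) * (6 / 7) ^ i) := by
    refine (chernoff_indicator_pi μ n (hA _) (by norm_num : (0 : ℝ) ≤ 1 / 2) (hgR i) _).trans
      (ENNReal.ofReal_le_ofReal ?_)
    have hX : 0 ≤ n * (((i : ℝ) + 1) * η) := by positivity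
    have hX' : ((i : ℝ) + 1) * (5 / 3) ≤ n * ((i + 1) * η) := by
      have : 0 ≤ (i : ℝ) := by positivity
      rw [hη]; nlinarith
    calc _ ≤ Real.exp (-(n * s) / 2 + i * (-(1 / 6))) := by
          refine Real.exp_le_exp.2 ?_
          nlinarith
      _ = Real.exp (-(n * s) / 2) * Real.exp (-(1 / 6)) ^ i := by
          rw [Real.exp_add, Real.exp_nat_mul]
      _ ≤ _ := by gcongr
  calc _ ≤ (Measure.pi fun _ : Fin n => μ) (⋃ i : ℕ, {x | 3 / 2 * n * ((i + 1) * η) + n * s ≤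
      ∑ k, (A (R i)).indicator (fun _ => (1 : ℝ)) (x k)}) := by
        refine measure_mono ?_
        rintro x ⟨r, hr, hx⟩
        set g := Real.exp (-r ^ 2 / (2 * σ ^ 2)) with hg
        have hg0 : 0 < g := Real.exp_pos _
        rw [mem_iUnion]
        refine ⟨⌊g / η⌋₊, ?_⟩
        have h1 : g ≤ (⌊g / η⌋₊ + 1) * η := by
          rw [← div_le_iff₀ hη0]; exact (Nat.lt_floor_add_one _).le
        have h2 : (⌊g / η⌋₊ : ℝ) * η ≤ g := by
          rw [← le_div_iff₀ hη0]; exact Nat.floor_le (by positivity)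
        have h3 : ∑ k, (A r).indicator (fun _ => (1 : ℝ)) (x k) ≤
            ∑ k, (A (R ⌊g / η⌋₊)).indicator (fun _ => (1 : ℝ)) (x k) :=
          Finset.sum_le_sum fun k _ => indicator_le_indicator_of_subset
            (hanti (hle _ hr h1)) (fun _ => zero_le_one) _
        simp only [mem_ofPred_eq]
        refine le_trans ?_ (hx.le.trans h3)
        have h4 : (⌊g / η⌋₊ + 1) * η ≤ g + 2 * s / 3 := by rw [add_mul, one_mul]; linarith
        calc _ ≤ 3 / 2 * n * (g + 2 * s / 3) + n * s := by gcongr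
          _ = _ := by ring
    _ ≤ ∑' i : ℕ, ENNReal.ofReal (Real.exp (-(n * s) / 2) * (6 / 7) ^ i) :=
        (measure_iUnion_le _).trans (ENNReal.tsum_le_tsum hbad)
    _ = ENNReal.ofReal (7 * Real.exp (-(n * s) / 2)) := by
        have hsum := (hasSum_geometric_of_lt_one (by norm_num : (0 : ℝ) ≤ 6 / 7)
          (by norm_num)).mul_left (Real.exp (-(n * s) / 2))
        rw [← ENNReal.ofReal_tsum_of_nonneg (fun i => by positivity) hsum.summable, hsum.tsum_eq]
        congr 1
        norm_num
        ring

lemma FiniteFirstMoment.map_eval {d : ℕ} {μ : Measure (EuclideanSpace ℝ (Fin d))}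
    (h : FiniteFirstMoment μ) (j : Fin d) : FiniteFirstMoment (μ.map fun y => y j) := by
  rw [FiniteFirstMoment, HasFiniteIntegral] at h ⊢
  rw [lintegral_map (by fun_prop) (by fun_prop)]
  refine lt_of_le_of_lt (lintegral_mono fun y => ?_) h
  simp only [enorm_norm]
  rw [← ofReal_norm, ← ofReal_norm]
  exact ENNReal.ofReal_le_ofReal (PiLp.norm_apply_le y j)

section Deterministic

variable {d : ℕ} {σ Δ s e : ℝ} {R Q : Measure (EuclideanSpace ℝ (Fin d))}
  [IsProbabilityMeasure R] [IsProbabilityMeasure Q]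

lemma offModes_real_le_of_W1_le (hσ : 0 < σ) (hs : 0 ≤ s) (he : 0 ≤ e)
    (hR1 : FiniteFirstMoment R) (hQ1 : FiniteFirstMoment Q) (j : Fin d)
    (hW : W1 (R.map fun y => y j) (Q.map fun y => y j) ≤ e)
    (hR : ∀ r, 0 ≤ r → R.real (offModes Δ j r) ≤
      3 / 2 * Real.exp (-r ^ 2 / (2 * σ ^ 2)) + 2 * s) (r : ℝ) (hr : 0 ≤ r) :
    Q.real (offModes Δ j r) ≤
      3 / 2 * Real.exp (-r ^ 2 / (2 * σ ^ 2)) + 2 * s + 5 / 2 * √(e / σ) := by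
  have hm : Measurable fun y : EuclideanSpace ℝ (Fin d) => y j := by fun_prop
  have : IsProbabilityMeasure (R.map fun y => y j) :=
    Measure.isProbabilityMeasure_map hm.aemeasurable
  have : IsProbabilityMeasure (Q.map fun y => y j) :=
    Measure.isProbabilityMeasure_map hm.aemeasurable
  have key (c : ℝ) (hc : e < c) : Q.real (offModes Δ j r) ≤
      3 / 2 * Real.exp (-r ^ 2 / (2 * σ ^ 2)) + 2 * s + 5 / 2 * √(c / σ) := by
    have hc0 : 0 < c := he.trans_lt hc
    set t := σ * √(c / σ) with ht
    have ht0 : 0 < t := by positivity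
    have htσ : t / σ = √(c / σ) := by rw [ht]; field_simp
    have hct : c / t = √(c / σ) := by
      rw [div_eq_iff ht0.ne', ht, mul_left_comm, Real.mul_self_sqrt (by positivity)]
      field_simp
    rcases le_or_gt r t with hrt | hrt
    · have h1 := gaussian_kernel_lipschitz hσ 0 hr
      have h2 : r / σ ≤ t / σ := by gcongr
      have h3 : Q.real (offModes Δ j r) ≤ 1 := measureReal_le_one
      have h4 : 0 ≤ √(c / σ) := by positivity
      simp only [zero_add, ne_eq, OfNat.ofNat_ne_zero, not_false_eq_true, zero_pow, neg_zero,
        zero_div, Real.exp_zero] at h1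
      linarith
    · obtain ⟨π, hπ, h1, h2, h3⟩ :=
        exists_coupling_of_W1_lt (hR1.map_eval j) (hQ1.map_eval j) (hW.trans_lt hc)
      let T : ℝ → Set ℝ := fun r => {y | r < |y - Δ| ∧ r < |y + Δ|}
      have hT (r : ℝ) : MeasurableSet (T r) :=
        (isOpen_lt (by fun_prop) (by fun_prop) |>.inter
          (isOpen_lt (by fun_prop) (by fun_prop)) :
            IsOpen ({y | r < |y - Δ|} ∩ {y | r < |y + Δ|})).measurableSet
      have e1 : R.real (offModes Δ j (r - t)) = π.real (Prod.fst ⁻¹' T (r - t)) := by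
        rw [← map_measureReal_apply measurable_fst (hT _), h1, map_measureReal_apply hm (hT _)]
        rfl
      have e2 : Q.real (offModes Δ j r) = π.real (Prod.snd ⁻¹' T r) := by
        rw [← map_measureReal_apply measurable_snd (hT _), h2, map_measureReal_apply hm (hT _)]
        rfl
      have hsub : Prod.snd ⁻¹' T r ⊆ Prod.fst ⁻¹' T (r - t) ∪ {p : ℝ × ℝ | t ≤ ‖p.1 - p.2‖} := by
        rintro ⟨x, y⟩ ⟨hy1, hy2⟩
        by_cases hxy : t ≤ ‖x - y‖
        · exact Or.inr hxy
        · rw [not_le, Real.norm_eq_abs, abs_sub_comm] at hxy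
          refine Or.inl ⟨?_, ?_⟩
          · have := abs_sub_le y x Δ
            simp only at hy1 ⊢
            linarith
          · have := abs_add_le (y - x) (x + Δ)
            rw [← add_assoc, sub_add_cancel] at this
            simp only at hy2 ⊢
            linarith
      have h4 := (measureReal_mono hsub (μ := π)).trans (measureReal_union_le _ _)
      have h5 := hR (r - t) (by linarith)
      have h6 := gaussian_kernel_lipschitz hσ (r - t) ht0.le
      rw [sub_add_cancel] at h6
      have h7 := h3 t ht0
      rw [← e1, ← e2] at h4
      linarith
  have hcont : Continuous fun c : ℝ =>
      3 / 2 * Real.exp (-r ^ 2 / (2 * σ ^ 2)) + 2 * s + 5 / 2 * √(c / σ) := by fun_prop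
  exact ge_of_tendsto (hcont.continuousWithinAt (s := Ioi e) (x := e))
    (eventually_nhdsWithin_of_forall key)

lemma abs_box_real_sub_le (hR1 : FiniteFirstMoment R) (hQ1 : FiniteFirstMoment Q) {c : ℝ} (hc : c = 1 ∨ c = -1)
    {m : EuclideanSpace ℝ (Fin d)} (hm : ∀ j, m j = c * Δ) {r : ℝ} (hr : r ∈ Ioo 0 Δ)
    {A B ω q : ℝ}
    (hA : ∀ j, R.real (offModes Δ j r) ≤ A) (hB : ∀ j, Q.real (offModes Δ j r) ≤ B)
    (hB0 : 0 ≤ d * B)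
    (hup : R.real (signOrthant c) ≤ ω + q) (hlo : ω - q ≤ R.real (signOrthant c)) :
    |Q.real {y | ∀ j : Fin d, |y j - m j| ≤ r} - ω| ≤
      q + d * A + d * B + W1 R Q / (2 * (Δ - r)) := by
  have hr2 := hr.2
  have hr1 := hr.1
  have ht0 : 0 < 2 * (Δ - r) := by linarith
  set D : Set (EuclideanSpace ℝ (Fin d)) := {y | ∀ j : Fin d, |y j - m j| ≤ r} with hD
  have hDm : MeasurableSet D := by
    have : D = ⋂ j, {y | |y j - m j| ≤ r} := by ext; simp [hD]
    rw [this]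
    exact MeasurableSet.iInter fun j => measurableSet_le (by fun_prop) (by fun_prop)
  have key (w : ℝ) (hw : W1 R Q < w) : |Q.real D - ω| ≤ q + d * A + d * B + w / (2 * (Δ - r)) := by
    obtain ⟨π, hπ, h1, h2, h3⟩ := exists_coupling_of_W1_lt hR1 hQ1 hw
    have e1 {S : Set (EuclideanSpace ℝ (Fin d))} (hS : MeasurableSet S) :
        R.real S = π.real (Prod.fst ⁻¹' S) := by
      rw [← map_measureReal_apply measurable_fst hS, h1]
    have e2 {S : Set (EuclideanSpace ℝ (Fin d))} (hS : MeasurableSet S) :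
        Q.real S = π.real (Prod.snd ⁻¹' S) := by
      rw [← map_measureReal_apply measurable_snd hS, h2]
    have hU (f : EuclideanSpace ℝ (Fin d) × EuclideanSpace ℝ (Fin d) → EuclideanSpace ℝ (Fin d))
        (K : ℝ) (hK : ∀ j, π.real (f ⁻¹' offModes Δ j r) ≤ K) :
        π.real (⋃ j, f ⁻¹' offModes Δ j r) ≤ d * K := by
      calc _ ≤ ∑ j, π.real (f ⁻¹' offModes Δ j r) := measureReal_iUnion_fintype_le _
        _ ≤ ∑ j : Fin d, K := Finset.sum_le_sum fun j _ => hK j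
        _ = d * K := by simp
    have hUA := hU Prod.fst A fun j => (e1 (measurableSet_offModes Δ j r)) ▸ hA j
    have hUB := hU Prod.snd B fun j => (e2 (measurableSet_offModes Δ j r)) ▸ hB j
    have hfar := h3 _ ht0
    have hcoord (x y : EuclideanSpace ℝ (Fin d)) (j : Fin d) (h : 2 * (Δ - r) ≤ |x j - y j|) :
        2 * (Δ - r) ≤ ‖x - y‖ := h.trans (PiLp.norm_apply_le (x - y) j)
    have hnear (x : EuclideanSpace ℝ (Fin d)) (j : Fin d) (h : x ∉ offModes Δ j r) :
        |x j - m j| ≤ r ∨ |x j + m j| ≤ r := by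
      simp only [offModes, mem_ofPred_eq, not_and_or, not_lt] at h
      rw [hm]
      rcases hc with rfl | rfl
      · simpa using h
      · simpa [← sub_eq_add_neg] using h.symm
    have hupS : Prod.snd ⁻¹' D ⊆ Prod.fst ⁻¹' signOrthant c ∪ (⋃ j, Prod.fst ⁻¹' offModes Δ j r) ∪
        {p | 2 * (Δ - r) ≤ ‖p.1 - p.2‖} := by
      rintro ⟨x, y⟩ hy
      by_contra hcon
      simp only [mem_union, mem_preimage, mem_iUnion, mem_ofPred_eq, not_or, not_exists] at hcon
      obtain ⟨⟨hx, hoff⟩, hxy⟩ := hcon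
      simp only [signOrthant, mem_ofPred_eq, not_forall, not_lt] at hx
      obtain ⟨j, hj⟩ := hx
      refine hxy (hcoord x y j ?_)
      have hyj : |y j - m j| ≤ r := hy j
      have hxj := hnear x j (hoff j)
      rw [hm] at hyj hxj
      rw [le_abs]
      simp only [abs_le] at hyj hxj
      rcases hc with rfl | rfl
      · right
        rcases hxj with h | h <;> linarith
      · left
        rcases hxj with h | h <;> linarith
    have hloS : Prod.fst ⁻¹' signOrthant c ⊆ Prod.snd ⁻¹' D ∪ (⋃ j, Prod.fst ⁻¹' offModes Δ j r) ∪
        (⋃ j, Prod.snd ⁻¹' offModes Δ j r) ∪ {p | 2 * (Δ - r) ≤ ‖p.1 - p.2‖} := by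
      rintro ⟨x, y⟩ hx
      by_contra hcon
      simp only [mem_union, mem_preimage, mem_iUnion, mem_ofPred_eq, not_or, not_exists] at hcon
      obtain ⟨⟨⟨hy, hoffx⟩, hoffy⟩, hxy⟩ := hcon
      simp only [hD, mem_ofPred_eq, not_forall, not_le] at hy
      obtain ⟨j, hj⟩ := hy
      refine hxy (hcoord x y j ?_)
      have hxj0 : 0 < c * x j := hx j
      have hyj := (hnear y j (hoffy j)).resolve_left hj.not_ge
      have hxj := hnear x j (hoffx j)
      rw [hm] at hyj hxj
      rw [le_abs]
      simp only [abs_le] at hyj hxj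
      rcases hc with rfl | rfl
      · left
        rcases hxj with h | h <;> linarith
      · right
        rcases hxj with h | h <;> linarith
    have hupM := (measureReal_mono hupS (μ := π)).trans ((measureReal_union_le _ _).trans
      (add_le_add_left (measureReal_union_le _ _) _))
    have hloM := (measureReal_mono hloS (μ := π)).trans ((measureReal_union_le _ _).trans
      (add_le_add_left ((measureReal_union_le _ _).trans
        (add_le_add_left (measureReal_union_le _ _) _)) _))
    rw [← e1 (measurableSet_signOrthant c), ← e2 hDm] at hupM hloM
    rw [abs_le]
    constructor <;> linarith
  have hcont : Continuous fun w : ℝ => q + d * A + d * B + w / (2 * (Δ - r)) := by fun_prop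
  exact ge_of_tendsto (hcont.continuousWithinAt (s := Ioi (W1 R Q)) (x := W1 R Q))
    (eventually_nhdsWithin_of_forall key)

end Deterministic

/-- (Corollary 4.3.1: Gaussian mixture.) Under the two-component
Gaussian mixture setup with component density `N(0, σ²I_d)`, with probability at
least `1 - δ` over the sample, every probability measure `Q` whose marginals are
within `ε_j` of the empirical marginals in 1-Wasserstein distance assigns to each
mode box a mass within
`4d exp(-r²/(2σ²)) + 8d√(max_j ε_j / σ) + 5d√(log(16d/δ)/(2n)) + W₁(P̂ⁿ, Q)/(2(Δ-r))`
of the true mode weight `w_k`. -/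
theorem mode_weight_recovery_gaussian {d n : ℕ} (hd : 0 < d) (hn : 0 < n)
    (σ Δ : ℝ) (hσ : 0 < σ) (hΔ : 0 < Δ)
    (w : Fin 2 → ℝ) (hw0 : w 0 ∈ Set.Icc (0 : ℝ) 1) (hw1 : w 1 = 1 - w 0)
    (mu : Fin 2 → EuclideanSpace ℝ (Fin d))
    (hmu0 : ∀ j, mu 0 j = Δ) (hmu1 : ∀ j, mu 1 j = -Δ)
    (ρ : EuclideanSpace ℝ (Fin d) → ℝ)
    (hρ : ∀ x, ρ x = (2 * Real.pi * σ ^ 2) ^ (-(d : ℝ) / 2) *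
      Real.exp (-‖x‖ ^ 2 / (2 * σ ^ 2)))
    (P : Measure (EuclideanSpace ℝ (Fin d))) [IsProbabilityMeasure P]
    (hP : P = volume.withDensity
      (fun x => ENNReal.ofReal (w 0 * ρ (x - mu 0) + w 1 * ρ (x - mu 1))))
    (ε : Fin d → ℝ) (hε : ∀ j, 0 ≤ ε j)
    (δ : ℝ) (hδ : δ ∈ Set.Ioo (0 : ℝ) 1) :
    ENNReal.ofReal (1 - δ) ≤
      (Measure.pi fun _ : Fin n => P)
        {x : Fin n → EuclideanSpace ℝ (Fin d) |
          ∀ (Q : Measure (EuclideanSpace ℝ (Fin d))), IsProbabilityMeasure Q →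
            FiniteFirstMoment Q →
            (∀ j : Fin d,
              W1 ((empMeasure x).map (fun y => y j)) (Q.map (fun y => y j)) ≤ ε j) →
            ∀ k : Fin 2, ∀ r ∈ Set.Ioo (0 : ℝ) Δ,
              |(Q {y | ∀ j : Fin d, |y j - mu k j| ≤ r}).toReal - w k| ≤
                4 * d * Real.exp (-r ^ 2 / (2 * σ ^ 2)) +
                  8 * d * Real.sqrt ((⨆ j : Fin d, ε j) / σ) +
                  5 * d * Real.sqrt (Real.log (16 * d / δ) / (2 * n)) +
                  W1 (empMeasure x) Q / (2 * (Δ - r))} := by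
  
  have hw0' := hw0.1
  have hw1' : 0 ≤ w 1 := by linarith [hw0.2]
  have hww : w 0 + w 1 = 1 := by linarith
  have hwk : ∀ k, 0 ≤ w k ∧ w k ≤ 1 := Fin.forall_fin_two.2
    ⟨hw0, hw1', by linarith⟩
  have hd1 : (1 : ℝ) ≤ d := by exact_mod_cast hd
  have hn0 : (0 : ℝ) < n := by exact_mod_cast hn
  have hδ0 := hδ.1
  have hδ1 := hδ.2
  have hε0 : 0 ≤ ⨆ j, ε j := Real.iSup_nonneg hε
  have hεj (j : Fin d) : ε j ≤ ⨆ j, ε j := le_ciSup (finite_range ε).bddAbove j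
  set L := Real.log (16 * d / δ) with hL
  have hexpL : Real.exp (-L) = δ / (16 * d) := by
    rw [Real.exp_neg, hL, Real.exp_log (by positivity), inv_div]
  have hL1 : 1 ≤ L := by
    rw [hL, Real.le_log_iff_exp_le (by positivity), le_div_iff₀ hδ0]
    have := Real.exp_one_lt_d9
    nlinarith [Real.exp_pos 1]
  set s := √(L / (2 * n)) with hs
  have hs0 : 0 < s := by positivity
  have hs2 : 2 * n * s ^ 2 = L := by
    rw [hs, Real.sq_sqrt (by positivity)]; field_simp
  have hW0 (R Q : Measure (EuclideanSpace ℝ (Fin d))) : 0 ≤ W1 R Q := by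
    refine Real.sInf_nonneg ?_
    rintro _ ⟨π, -, -, -, rfl⟩
    positivity
  rcases le_or_gt 1 (5 * d * s) with hbig | hsmall
  · refine (ENNReal.ofReal_le_one.2 (by linarith)).trans ?_
    rw [← measure_univ (μ := Measure.pi fun _ : Fin n => P)]
    refine measure_mono fun x _ Q hQ _ _ k r hr => ?_
    have h1 : Q.real {y | ∀ j : Fin d, |y j - mu k j| ≤ r} ≤ 1 := measureReal_le_one
    have h2 : 0 ≤ Q.real {y | ∀ j : Fin d, |y j - mu k j| ≤ r} := measureReal_nonneg
    have h3 : |Q.real {y | ∀ j : Fin d, |y j - mu k j| ≤ r} - w k| ≤ 1 := by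
      rw [abs_le]
      constructor <;> linarith [(hwk k).1, (hwk k).2]
    have h4 : 0 ≤ W1 (empMeasure x) Q / (2 * (Δ - r)) :=
      div_nonneg (hW0 _ _) (by linarith [hr.2])
    have h5 : 0 ≤ 4 * d * Real.exp (-r ^ 2 / (2 * σ ^ 2)) := by positivity
    have h6 : 0 ≤ 8 * d * √((⨆ j, ε j) / σ) := by positivity
    rw [measureReal_def] at h3
    linarith
  have hns : 5 / 2 * L ≤ n * s := by
    have h1 : s ≤ 1 / 5 := by nlinarith
    have : 0 < n * s := by positivity
    nlinarith
  set N := volume.withDensity fun x => ENNReal.ofReal (ρ x) with hN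
  have hρm : Measurable ρ := by rw [funext hρ]; fun_prop
  have hρ0 (x : EuclideanSpace ℝ (Fin d)) : 0 ≤ ρ x := by rw [hρ]; positivity
  have hPN (S : Set (EuclideanSpace ℝ (Fin d))) (hS : MeasurableSet S) :
      P S = ENNReal.ofReal (w 0) * N {x | x + mu 0 ∈ S} +
        ENNReal.ofReal (w 1) * N {x | x + mu 1 ∈ S} := by
    rw [hP]; exact mixture_withDensity_apply hρm hρ0 hw0' hw1' _ _ hS
  have hN1 : N univ = 1 := by
    have h := hPN univ MeasurableSet.univ
    simpa [← add_mul, ← ENNReal.ofReal_add hw0' hw1', hww] using h.symm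
  have hNp : IsProbabilityMeasure N := ⟨hN1⟩
  have hPr (S : Set (EuclideanSpace ℝ (Fin d))) (hS : MeasurableSet S) :
      P.real S = w 0 * N.real {x | x + mu 0 ∈ S} + w 1 * N.real {x | x + mu 1 ∈ S} := by
    rw [measureReal_def, hPN S hS, ENNReal.toReal_add (by finiteness) (by finiteness),
      ENNReal.toReal_mul, ENNReal.toReal_mul, ENNReal.toReal_ofReal hw0',
      ENNReal.toReal_ofReal hw1']
    rfl
  have htail (j : Fin d) (r : ℝ) (hr : 0 ≤ r) :
      P.real (offModes Δ j r) ≤ Real.exp (-r ^ 2 / (2 * σ ^ 2)) :=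
    mixture_real_offModes_le hw0' hw1' hww hPr hmu0 hmu1 j
      (ENNReal.toReal_le_of_le_ofReal (Real.exp_pos _).le
        (gaussian_withDensity_abs_le hρ hN1 j hr))
  set γ := Real.exp (-Δ ^ 2 / (2 * σ ^ 2)) with hγ
  have hhalf (j : Fin d) (e : ℝ) (he : e ^ 2 = 1) : N.real {x | Δ ≤ e * x j} ≤ γ :=
    ENNReal.toReal_le_of_le_ofReal (Real.exp_pos _).le
      (gaussian_withDensity_halfspace_le hρ hN1 j he hΔ.le)
  let c : Fin 2 → ℝ := ![1, -1]
  have hc : ∀ k, c k = 1 ∨ c k = -1 := Fin.forall_fin_two.2 ⟨Or.inl rfl, Or.inr rfl⟩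
  have hmu : ∀ k j, mu k j = c k * Δ := Fin.forall_fin_two.2
    ⟨by simpa [c] using hmu0, by simpa [c] using hmu1⟩
  have horth : ∀ k, P.real (signOrthant (c k)) ≤ w k + γ ∧
      w k - d * γ ≤ P.real (signOrthant (c k)) := Fin.forall_fin_two.2
    ⟨mixture_real_signOrthant hd hw0' hw1' hww hPr (by norm_num [c]) (hmu 0)
        (by simpa [c] using hmu1) hhalf,
      mixture_real_signOrthant hd hw1' hw0' (by linarith)
        (fun S hS => (hPr S hS).trans (add_comm _ _)) (by norm_num [c]) (hmu 1)
        (by simpa [c] using hmu0) hhalf⟩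
  set μ := Measure.pi fun _ : Fin n => P with hμ
  let U : Fin d → Set (Fin n → EuclideanSpace ℝ (Fin d)) := fun j => {x | ∃ r, 0 ≤ r ∧
    3 / 2 * n * Real.exp (-r ^ 2 / (2 * σ ^ 2)) + 2 * n * s <
      ∑ i, (offModes Δ j r).indicator (fun _ => (1 : ℝ)) (x i)}
  let V : Set (EuclideanSpace ℝ (Fin d)) → Set (Fin n → EuclideanSpace ℝ (Fin d)) := fun A =>
    {x | n * (P.real A + s) ≤ ∑ i, A.indicator (fun _ => (1 : ℝ)) (x i)}
  have hU (j : Fin d) : μ (U j) ≤ ENNReal.ofReal (7 * (δ / (16 * d))) := by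
    refine (uniform_tail_pi P (measurableSet_offModes Δ j) (antitone_offModes Δ j) hσ (htail j)
      hs0 (by linarith)).trans (ENNReal.ofReal_le_ofReal ?_)
    rw [← hexpL]
    gcongr
    linarith
  have hV (A : Set (EuclideanSpace ℝ (Fin d))) (hA : MeasurableSet A) :
      μ (V A) ≤ ENNReal.ofReal (δ / (16 * d)) := by
    refine (hoeffding_indicator_pi P hn hA hs0.le).trans_eq ?_
    rw [← hexpL, ← hs2]
    ring_nf
  let H : Fin 2 → Set (EuclideanSpace ℝ (Fin d)) := fun k => signOrthant (c k)
  have hH (k : Fin 2) : MeasurableSet (H k) := measurableSet_signOrthant _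
  let bad := (⋃ j, U j) ∪ ⋃ k, (V (H k) ∪ V (H k)ᶜ)
  have hbad : μ bad ≤ ENNReal.ofReal δ := by
    have h16 : 0 ≤ δ / (16 * d) := by positivity
    calc μ bad ≤ ∑ j, μ (U j) + ∑ k, (μ (V (H k)) + μ (V (H k)ᶜ)) :=
          (measure_union_le _ _).trans (add_le_add (measure_iUnion_fintype_le _ _)
            ((measure_iUnion_fintype_le _ _).trans
              (Finset.sum_le_sum fun k _ => measure_union_le _ _)))
      _ ≤ ∑ j : Fin d, ENNReal.ofReal (7 * (δ / (16 * d))) +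
          ∑ k : Fin 2, (ENNReal.ofReal (δ / (16 * d)) + ENNReal.ofReal (δ / (16 * d))) := by
          gcongr with j _ k _
          · exact hU j
          · exact hV _ (hH k)
          · exact hV _ (hH k).compl
      _ = ENNReal.ofReal (d * (7 * (δ / (16 * d))) + 4 * (δ / (16 * d))) := by
          rw [ENNReal.ofReal_add (by positivity) (by positivity), ENNReal.ofReal_mul (by positivity),
            ENNReal.ofReal_mul (by norm_num : (0 : ℝ) ≤ 4)]
          simp
          ring
      _ ≤ ENNReal.ofReal δ := by
          refine ENNReal.ofReal_le_ofReal ?_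
          have h1 : d * (7 * (δ / (16 * d))) = 7 / 16 * δ := by field_simp
          have h2 : δ / (16 * d) ≤ δ / 16 := by
            gcongr
            linarith
          linarith
  rw [ENNReal.ofReal_sub _ hδ0.le, ENNReal.ofReal_one, tsub_le_iff_right,
    ← measure_univ (μ := μ)]
  refine le_trans (measure_mono fun x _ => ?_) ((measure_union_le _ bad).trans
    (add_le_add_right hbad _))
  refine or_iff_not_imp_right.2 fun hx Q hQ hQ1 hQW k r hr => ?_
  simp only [bad, U, V, mem_union, mem_iUnion, mem_ofPred_eq, not_or, not_exists, not_and, not_lt,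
    not_le] at hx
  obtain ⟨hxU, hxV⟩ := hx
  have hRp := isProbabilityMeasure_empMeasure hn x
  have hR1 := finiteFirstMoment_empMeasure hn x
  have hRtail (j : Fin d) (r : ℝ) (hr : 0 ≤ r) : (empMeasure x).real (offModes Δ j r) ≤
      3 / 2 * Real.exp (-r ^ 2 / (2 * σ ^ 2)) + 2 * s := by
    have h := hxU j r hr
    rw [← empMeasure_real x (measurableSet_offModes Δ j r)] at h
    refine le_of_mul_le_mul_left (h.trans_eq ?_) hn0
    ring
  obtain ⟨hV1, hV2⟩ := hxV k
  rw [← empMeasure_real x (hH k)] at hV1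
  rw [← empMeasure_real x (hH k).compl, probReal_compl_eq_one_sub (hH k),
    probReal_compl_eq_one_sub (hH k)] at hV2
  have hV1' := lt_of_mul_lt_mul_left hV1 hn0.le
  have hV2' := lt_of_mul_lt_mul_left hV2 hn0.le
  have hγ0 : 0 < γ := Real.exp_pos _
  have hdγ : γ ≤ d * γ := by nlinarith
  have hbox := abs_box_real_sub_le hR1 hQ1 (hc k) (hmu k) hr (ω := w k) (q := d * γ + s)
    (fun j => hRtail j r hr.1.le)
    (fun j => offModes_real_le_of_W1_le hσ hs0.le hε0 hR1 hQ1 j ((hQW j).trans (hεj j))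
      (hRtail j) r hr.1.le) (by positivity)
    (by linarith [(horth k).1]) (by linarith [(horth k).2])
  have hγr : γ ≤ Real.exp (-r ^ 2 / (2 * σ ^ 2)) := by
    have := hr.1
    have := hr.2
    rw [hγ]
    gcongr
  refine hbox.trans ?_
  have hdγr := mul_le_mul_of_nonneg_left hγr (by linarith : (0 : ℝ) ≤ d)
  have hds : s ≤ d * s := by nlinarith
  have hsq : 0 ≤ d * √((⨆ j, ε j) / σ) := by positivity
  linarith
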